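/- Let m, n ≥ 3 be odd integers. In the m×n hitomezashi pattern with labels ε_0 = ε_n = η_0 = η_m = 1 and all other labels equal to 0, there is a hitomezashi loop R_{m,n} with width(R_{m,n}) = n, height(R_{m,n}) = m, length(R_{m,n}) = 4m + 4n − 12, and area(R_{m,n}) = mn − m − n + 2. -/

import Mathlib

/-- A stitch is a unit segment of the grid: `vert i j` is the vertical segment from
`(i,j)` to `(i,j+1)`; `horiz i j` is the horizontal segment from `(i,j)` to `(i+1,j)`. -/
inductive Stitch : Type
  | vert : ℤ → ℤ → Stitch
  | horiz : ℤ → ℤ → Stitch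
  deriving DecidableEq

/-- Membership of a stitch in the hitomezashi pattern with labels `ε` (vertical lines)
and `η` (horizontal lines). -/
def Stitch.InPattern (ε η : ℤ → ZMod 2) : Stitch → Prop
  | .vert i j => (j : ZMod 2) = ε i
  | .horiz i j => (i : ZMod 2) = η j

/-- The stitch as a subset of the plane. -/
def Stitch.seg : Stitch → Set (ℝ × ℝ)
  | .vert i j => segment ℝ ((i : ℝ), (j : ℝ)) ((i : ℝ), (j : ℝ) + 1)
  | .horiz i j => segment ℝ ((i : ℝ), (j : ℝ)) ((i : ℝ) + 1, (j : ℝ))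

/-- The union of the segments of a set of stitches. -/
def curveOf (S : Set Stitch) : Set (ℝ × ℝ) := ⋃ s ∈ S, s.seg

/-- `C` is a simple closed curve: it is homeomorphic to a circle. -/
def IsCircle (C : Set (ℝ × ℝ)) : Prop :=
  Nonempty (C ≃ₜ Metric.sphere (0 : ℝ × ℝ) 1)

/-- The interior of a closed curve `C`: the union of the bounded connected
components of its complement. -/
def intOf (C : Set (ℝ × ℝ)) : Set (ℝ × ℝ) :=
  {p | p ∉ C ∧ Bornology.IsBounded (connectedComponentIn Cᶜ p)}

/-- The exterior of a closed curve `C`: the union of the unbounded connected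
components of its complement. -/
def extOf (C : Set (ℝ × ℝ)) : Set (ℝ × ℝ) :=
  {p | p ∉ C ∧ ¬ Bornology.IsBounded (connectedComponentIn Cᶜ p)}

/-- The open unit cell with southwest corner `(i,j)`. -/
def cell (i j : ℤ) : Set (ℝ × ℝ) :=
  Set.Ioo (i : ℝ) ((i : ℝ) + 1) ×ˢ Set.Ioo (j : ℝ) ((j : ℝ) + 1)

/-- A hitomezashi loop in the pattern with labels `ε`, `η`: a (finite) set of stitches
of the pattern whose union is a simple closed curve. -/
structure HLoop (ε η : ℤ → ZMod 2) where
  stitches : Finset Stitch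
  inPattern : ∀ s ∈ stitches, s.InPattern ε η
  isCircle : IsCircle (curveOf ↑stitches)

/-- The width of a loop: difference between maximal and minimal x-coordinates of its points. -/
noncomputable def loopWidth {ε η : ℤ → ZMod 2} (L : HLoop ε η) : ℝ :=
  sSup (Prod.fst '' curveOf ↑L.stitches) - sInf (Prod.fst '' curveOf ↑L.stitches)

/-- The height of a loop: difference between maximal and minimal y-coordinates of its points. -/
noncomputable def loopHeight {ε η : ℤ → ZMod 2} (L : HLoop ε η) : ℝ :=
  sSup (Prod.snd '' curveOf ↑L.stitches) - sInf (Prod.snd '' curveOf ↑L.stitches)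

/-- A lattice point, regarded as a point of the plane. -/
def latticePoint (a : ℤ × ℤ) : ℝ × ℝ := ((a.1 : ℝ), (a.2 : ℝ))

/-- Two lattice points at distance one. -/
def LatticeAdj (a b : ℤ × ℤ) : Prop :=
  (a.1 = b.1 ∧ (b.2 = a.2 + 1 ∨ a.2 = b.2 + 1)) ∨
    (a.2 = b.2 ∧ (b.1 = a.1 + 1 ∨ a.1 = b.1 + 1))

/-- The stitch joining two adjacent lattice points. -/
def Stitch.between (a b : ℤ × ℤ) : Stitch :=
  if a.1 = b.1 then .vert a.1 (min a.2 b.2) else .horiz (min a.1 b.1) a.2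

lemma Stitch.mem_seg_vert {i j : ℤ} {q : ℝ × ℝ} :
    q ∈ (Stitch.vert i j).seg ↔ q.1 = i ∧ (j : ℝ) ≤ q.2 ∧ q.2 ≤ j + 1 := by
  obtain ⟨x, y⟩ := q
  rw [Stitch.seg, ← Prod.image_mk_segment_right, segment_eq_Icc (by linarith)]
  simp only [Set.mem_image, Set.mem_Icc, Prod.mk.injEq]
  constructor
  · rintro ⟨t, ht, rfl, rfl⟩
    exact ⟨rfl, ht⟩
  · rintro ⟨h, hy⟩
    exact ⟨y, hy, h.symm, rfl⟩

lemma Stitch.mem_seg_horiz {i j : ℤ} {q : ℝ × ℝ} :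
    q ∈ (Stitch.horiz i j).seg ↔ q.2 = j ∧ (i : ℝ) ≤ q.1 ∧ q.1 ≤ i + 1 := by
  obtain ⟨x, y⟩ := q
  rw [Stitch.seg, ← Prod.image_mk_segment_left, segment_eq_Icc (by linarith)]
  simp only [Set.mem_image, Set.mem_Icc, Prod.mk.injEq]
  constructor
  · rintro ⟨t, ht, rfl, rfl⟩
    exact ⟨rfl, ht⟩
  · rintro ⟨h, hx⟩
    exact ⟨x, hx, rfl, h.symm⟩

lemma Stitch.seg_between {a b : ℤ × ℤ} (h : LatticeAdj a b) :
    (Stitch.between a b).seg = segment ℝ (latticePoint a) (latticePoint b) := by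
  obtain ⟨a₁, a₂⟩ := a
  obtain ⟨b₁, b₂⟩ := b
  simp only [LatticeAdj] at h
  rcases h with ⟨rfl, rfl | rfl⟩ | ⟨rfl, rfl | rfl⟩
  · simp [Stitch.between, Stitch.seg, latticePoint]
  · simp [Stitch.between, Stitch.seg, latticePoint, segment_symm]
  · simp [Stitch.between, Stitch.seg, latticePoint]
  · simp [Stitch.between, Stitch.seg, latticePoint, segment_symm]

lemma Stitch.eq_or_swap_of_between_eq {a b c d : ℤ × ℤ} (hab : LatticeAdj a b)
    (hcd : LatticeAdj c d) (h : Stitch.between a b = Stitch.between c d) :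
    (a = c ∧ b = d) ∨ (a = d ∧ b = c) := by
  obtain ⟨a₁, a₂⟩ := a
  obtain ⟨b₁, b₂⟩ := b
  obtain ⟨c₁, c₂⟩ := c
  obtain ⟨d₁, d₂⟩ := d
  simp only [LatticeAdj] at hab hcd
  simp only [Stitch.between] at h
  simp only [Prod.mk.injEq]
  split_ifs at h <;> simp only [Stitch.vert.injEq, Stitch.horiz.injEq] at h <;> omega

/-- A stitch through a non-lattice point is determined by it. -/
lemma Stitch.eq_of_mem_seg {s t : Stitch} {q : ℝ × ℝ} (hs : q ∈ s.seg) (ht : q ∈ t.seg)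
    (hq : ∀ a, q ≠ latticePoint a) : s = t := by
  obtain ⟨x, y⟩ := q
  have key : ∀ (i k : ℤ) (z : ℝ), (i : ℝ) ≤ z → z ≤ i + 1 → (k : ℝ) ≤ z → z ≤ k + 1 →
      (∀ l : ℤ, z ≠ l) → i = k := by
    intro i k z h1 h2 h3 h4 h
    have h5 := lt_of_le_of_ne h1 (h i).symm
    have h6 := lt_of_le_of_ne h3 (h k).symm
    have h7 := lt_of_le_of_ne h2 (by exact_mod_cast h (i + 1))
    have h8 := lt_of_le_of_ne h4 (by exact_mod_cast h (k + 1))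
    have h9 : (i : ℝ) < k + 1 := by linarith
    have h10 : (k : ℝ) < i + 1 := by linarith
    norm_cast at h9 h10
    omega
  cases s with
  | vert i j =>
    obtain ⟨h1, h2, h3⟩ := Stitch.mem_seg_vert.1 hs
    simp only at h1 h2 h3
    have hy : ∀ l : ℤ, y ≠ l := fun l hl => hq (i, l) (by simp [latticePoint, h1, hl])
    cases t with
    | vert k l =>
      obtain ⟨h4, h5, h6⟩ := Stitch.mem_seg_vert.1 ht
      simp only at h4 h5 h6
      have : i = k := by exact_mod_cast h1.symm.trans h4
      rw [this, key j l y h2 h3 h5 h6 hy]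
    | horiz k l => exact absurd (Stitch.mem_seg_horiz.1 ht).1 (hy l)
  | horiz i j =>
    obtain ⟨h1, h2, h3⟩ := Stitch.mem_seg_horiz.1 hs
    simp only at h1 h2 h3
    have hx : ∀ l : ℤ, x ≠ l := fun l hl => hq (l, j) (by simp [latticePoint, h1, hl])
    cases t with
    | vert k l => exact absurd (Stitch.mem_seg_vert.1 ht).1 (hx k)
    | horiz k l =>
      obtain ⟨h4, h5, h6⟩ := Stitch.mem_seg_horiz.1 ht
      simp only at h4 h5 h6
      have : j = l := by exact_mod_cast h1.symm.trans h4
      rw [this, key i k x h2 h3 h5 h6 hx]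

/-- The point at parameter `θ` of the segment between adjacent lattice points is not a lattice
point if `0 < θ < 1`. -/
lemma latticePoint_ne_of_mem_Ioo {a b : ℤ × ℤ} (h : LatticeAdj a b) {θ : ℝ} (h0 : 0 < θ)
    (h1 : θ < 1) (c : ℤ × ℤ) :
    (1 - θ) • latticePoint a + θ • latticePoint b ≠ latticePoint c := by
  obtain ⟨a₁, a₂⟩ := a
  obtain ⟨b₁, b₂⟩ := b
  obtain ⟨c₁, c₂⟩ := c
  have key : ∀ u v : ℤ, (u : ℝ) + θ ≠ v := by
    intro u v huv
    have h2 : (u : ℝ) < v := by linarith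
    have h3 : (v : ℝ) < u + 1 := by linarith
    norm_cast at h2 h3
    omega
  simp only [LatticeAdj] at h
  intro he
  simp only [latticePoint, Prod.smul_mk, Prod.mk_add_mk, Prod.mk.injEq, smul_eq_mul] at he
  obtain ⟨e1, e2⟩ := he
  rcases h with ⟨rfl, rfl | rfl⟩ | ⟨rfl, rfl | rfl⟩ <;> push_cast at e1 e2
  · exact key a₂ c₂ (by linarith)
  · exact key (-b₂ - 1) (-c₂) (by push_cast; linarith)
  · exact key a₁ c₁ (by linarith)
  · exact key (-b₁ - 1) (-c₁) (by push_cast; linarith)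

lemma latticePoint_injective : Function.Injective latticePoint := by
  rintro ⟨a₁, a₂⟩ ⟨b₁, b₂⟩ h
  simpa [latticePoint] using h

lemma latticePoint_ne_of_adj {a b : ℤ × ℤ} (h : LatticeAdj a b) : a ≠ b := by
  rintro rfl
  simp only [LatticeAdj] at h
  omega

/-- The piecewise linear path that is at `p k` at time `k`, for `0 ≤ k ≤ N`. -/
noncomputable def polyline (N : ℕ) (p : ℕ → ℤ × ℤ) (t : ℝ) : ℝ × ℝ :=
  ∑ k ∈ Finset.range (N + 1), max 0 (1 - |t - k|) • latticePoint (p k)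

lemma continuous_polyline (N : ℕ) (p : ℕ → ℤ × ℤ) : Continuous (polyline N p) := by
  unfold polyline
  fun_prop

lemma polyline_add {N : ℕ} (p : ℕ → ℤ × ℤ) {k : ℕ} (hk : k < N) {θ : ℝ} (h0 : 0 ≤ θ)
    (h1 : θ ≤ 1) :
    polyline N p (k + θ) = (1 - θ) • latticePoint (p k) + θ • latticePoint (p (k + 1)) := by
  rw [polyline, ← Finset.sum_subset (s₁ := {k, k + 1}), Finset.sum_pair (by omega)]
  · congr 2
    · rw [add_sub_cancel_left, abs_of_nonneg h0, max_eq_right (by linarith)]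
    · have : (k : ℝ) + θ - ((k + 1 : ℕ) : ℝ) = -(1 - θ) := by push_cast; ring
      rw [this, abs_neg, abs_of_nonneg (by linarith), max_eq_right (by linarith)]
      ring
  · intro l hl
    simp only [Finset.mem_insert, Finset.mem_singleton] at hl
    simp only [Finset.mem_range]
    omega
  · intro l _ hl
    simp only [Finset.mem_insert, Finset.mem_singleton, not_or] at hl
    rw [max_eq_left, zero_smul]
    rcases lt_or_gt_of_ne hl.1 with h | h
    · have : (l : ℝ) + 1 ≤ k := by exact_mod_cast h
      have := le_abs_self ((k : ℝ) + θ - l)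
      linarith
    · have : (k : ℝ) + 2 ≤ l := by exact_mod_cast (by omega : k + 2 ≤ l)
      have := neg_le_abs ((k : ℝ) + θ - l)
      linarith

lemma exists_nat_add_of_mem_Ico {N : ℕ} {t : ℝ} (ht : t ∈ Set.Ico (0 : ℝ) N) :
    ∃ k < N, ∃ θ : ℝ, 0 ≤ θ ∧ θ < 1 ∧ t = k + θ := by
  refine ⟨⌊t⌋₊, (Nat.floor_lt ht.1).2 ht.2, t - ⌊t⌋₊, ?_, ?_, by ring⟩
  · linarith [Nat.floor_le ht.1]
  · linarith [Nat.lt_floor_add_one t]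

section Cycle

variable {N : ℕ} {p : ℕ → ℤ × ℤ}

lemma between_injOn (hN : 3 ≤ N) (hclosed : p N = p 0) (hinj : Set.InjOn p (Set.Iio N))
    (hadj : ∀ k < N, LatticeAdj (p k) (p (k + 1))) {k l : ℕ} (hk : k < N) (hl : l < N)
    (h : Stitch.between (p k) (p (k + 1)) = Stitch.between (p l) (p (l + 1))) : k = l := by
  rcases Stitch.eq_or_swap_of_between_eq (hadj k hk) (hadj l hl) h with ⟨h1, -⟩ | ⟨h1, h2⟩
  · exact hinj hk hl h1
  have hcyc : ∀ u < N, ∃ v < N, p (u + 1) = p v ∧ (v = u + 1 ∨ u + 1 = N ∧ v = 0) := by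
    intro u hu
    by_cases h : u + 1 < N
    · exact ⟨u + 1, h, rfl, Or.inl rfl⟩
    · have : u + 1 = N := by omega
      exact ⟨0, by omega, by rw [this, hclosed], Or.inr ⟨this, rfl⟩⟩
  obtain ⟨u, hu, hpu, hu'⟩ := hcyc k hk
  obtain ⟨v, hv, hpv, hv'⟩ := hcyc l hl
  have e1 : k = v := hinj hk hv (h1.trans hpv)
  have e2 : u = l := hinj hu hl (hpu.symm.trans h2)
  omega

lemma polyline_injOn (hN : 3 ≤ N) (hclosed : p N = p 0) (hinj : Set.InjOn p (Set.Iio N))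
    (hadj : ∀ k < N, LatticeAdj (p k) (p (k + 1))) :
    Set.InjOn (polyline N p) (Set.Ico 0 N) := by
  intro s hs t ht hst
  obtain ⟨k, hk, θ, h0, h1, rfl⟩ := exists_nat_add_of_mem_Ico hs
  obtain ⟨l, hl, φ, g0, g1, rfl⟩ := exists_nat_add_of_mem_Ico ht
  rw [polyline_add p hk h0 h1.le, polyline_add p hl g0 g1.le] at hst
  rcases h0.eq_or_lt with rfl | h0
  · rcases g0.eq_or_lt with rfl | g0
    · simp only [sub_zero, one_smul, zero_smul, add_zero] at hst
      rw [hinj hk hl (latticePoint_injective hst)]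
    · exact absurd (by simpa using hst.symm) (latticePoint_ne_of_mem_Ioo (hadj l hl) g0 g1 (p k))
  · rcases g0.eq_or_lt with rfl | g0
    · exact absurd (by simpa using hst) (latticePoint_ne_of_mem_Ioo (hadj k hk) h0 h1 (p l))
    · have hkl : k = l := by
        refine between_injOn hN hclosed hinj hadj hk hl (Stitch.eq_of_mem_seg
          (q := (1 - θ) • latticePoint (p k) + θ • latticePoint (p (k + 1))) ?_ ?_
          (latticePoint_ne_of_mem_Ioo (hadj k hk) h0 h1))
        · rw [Stitch.seg_between (hadj k hk)]
          exact ⟨1 - θ, θ, by linarith, h0.le, by ring, rfl⟩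
        · rw [hst, Stitch.seg_between (hadj l hl)]
          exact ⟨1 - φ, φ, by linarith, g0.le, by ring, rfl⟩
      subst hkl
      have hne : latticePoint (p (k + 1)) - latticePoint (p k) ≠ 0 :=
        sub_ne_zero.2 fun h => latticePoint_ne_of_adj (hadj k hk) (latticePoint_injective h).symm
      have : (θ - φ) • (latticePoint (p (k + 1)) - latticePoint (p k)) = 0 := by
        rw [← sub_eq_zero] at hst
        rw [← hst]
        module
      rcases smul_eq_zero.1 this with h | h
      · rw [sub_eq_zero.1 h]
      · exact absurd h hne

lemma image_polyline (hclosed : p N = p 0) (hadj : ∀ k < N, LatticeAdj (p k) (p (k + 1))) :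
    polyline N p '' Set.Ico 0 N =
      ⋃ k ∈ Set.Iio N, (Stitch.between (p k) (p (k + 1))).seg := by
  ext q
  simp only [Set.mem_image, Set.mem_iUnion, Set.mem_Iio]
  constructor
  · rintro ⟨t, ht, rfl⟩
    obtain ⟨k, hk, θ, h0, h1, rfl⟩ := exists_nat_add_of_mem_Ico ht
    refine ⟨k, hk, ?_⟩
    rw [polyline_add p hk h0 h1.le, Stitch.seg_between (hadj k hk)]
    exact ⟨1 - θ, θ, by linarith, h0, by ring, rfl⟩
  · rintro ⟨k, hk, hq⟩
    rw [Stitch.seg_between (hadj k hk)] at hq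
    obtain ⟨a, θ, ha, h0, hsum, rfl⟩ := hq
    obtain rfl : a = 1 - θ := by linarith
    have hk' : (k : ℝ) + 1 ≤ N := by exact_mod_cast hk
    rcases (sub_nonneg.1 ha).eq_or_lt with rfl | h1
    · rcases hk'.eq_or_lt with h | h
      · refine ⟨0, ⟨le_rfl, by linarith [k.cast_nonneg (α := ℝ)]⟩, ?_⟩
        have hkN : k + 1 = N := by exact_mod_cast h
        have := polyline_add p (k := 0) (N := N) (by omega) le_rfl zero_le_one
        simp only [Nat.cast_zero, add_zero] at this
        simp [this, hkN, hclosed]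
      · refine ⟨k + 1, ⟨by positivity, h⟩, polyline_add p hk zero_le_one le_rfl⟩
    · exact ⟨k + θ, ⟨by positivity, by linarith⟩, polyline_add p hk h0 h1.le⟩

end Cycle

/-- The unit circle is homeomorphic to the unit sphere of the supremum norm on the plane. -/
lemma nonempty_circle_homeomorph_sphere :
    Nonempty (Circle ≃ₜ Metric.sphere (0 : ℝ × ℝ) 1) := by
  let e := Complex.equivRealProdCLM
  obtain ⟨h, -, -, hh⟩ := exists_homeomorph_image_interior_closure_frontier_eq_unitBall
    (s := e '' Metric.closedBall 0 1)
    ((convex_closedBall (0 : ℂ) 1).is_linear_image e.toLinearMap.isLinear)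
    (by
      have := e.toHomeomorph.image_interior (Metric.closedBall 0 1)
      rw [show ⇑e = ⇑e.toHomeomorph from rfl, ← this,
        interior_closedBall _ one_ne_zero]
      exact (Metric.nonempty_ball.2 one_pos).image _)
    ((isCompact_closedBall (0 : ℂ) 1).image e.continuous).isBounded
  rw [show ⇑e = ⇑e.toHomeomorph from rfl, ← e.toHomeomorph.image_frontier,
    frontier_closedBall _ one_ne_zero, Set.image_image] at hh
  refine ⟨(?_ : Metric.sphere (0 : ℂ) 1 ≃ₜ Metric.sphere (0 : ℝ × ℝ) 1)⟩
  exact ((e.toHomeomorph.trans h).image (Metric.sphere 0 1)).trans (Homeomorph.setCongr hh)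

/-- A closed lattice walk without repeated vertices traces a simple closed curve. -/
theorem isCircle_of_lattice_cycle {N : ℕ} {p : ℕ → ℤ × ℤ} (hN : 3 ≤ N) (hclosed : p N = p 0)
    (hinj : Set.InjOn p (Set.Iio N)) (hadj : ∀ k < N, LatticeAdj (p k) (p (k + 1))) :
    IsCircle (⋃ k ∈ Set.Iio N, (Stitch.between (p k) (p (k + 1))).seg) := by
  have hpos : (0 : ℝ) < N := by exact_mod_cast (by omega : 0 < N)
  have : Fact ((0 : ℝ) < N) := ⟨hpos⟩
  let F : AddCircle (N : ℝ) → ℝ × ℝ := AddCircle.liftIco (N : ℝ) 0 (polyline N p)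
  have hF : ∀ t ∈ Set.Ico (0 : ℝ) N, F t = polyline N p t := fun t ht =>
    AddCircle.liftIco_coe_apply (by simpa using ht)
  have hrep : ∀ x : AddCircle (N : ℝ), ∃ t ∈ Set.Ico (0 : ℝ) N, (t : AddCircle (N : ℝ)) = x := by
    intro x
    have := (AddCircle.coe_image_Ico_eq (N : ℝ) 0).symm ▸ Set.mem_univ x
    simpa using this
  have hcont : Continuous F := by
    refine AddCircle.liftIco_continuous ?_ (continuous_polyline N p).continuousOn
    have h1 := polyline_add p (k := 0) (N := N) (by omega) le_rfl zero_le_one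
    have h2 := polyline_add p (k := N - 1) (N := N) (by omega) zero_le_one le_rfl
    rw [← Nat.cast_add_one, Nat.sub_add_cancel (by omega)] at h2
    simp only [Nat.cast_zero, add_zero] at h1
    simp [h1, h2, hclosed]
  have hFinj : Function.Injective F := by
    intro x y hxy
    obtain ⟨s, hs, rfl⟩ := hrep x
    obtain ⟨t, ht, rfl⟩ := hrep y
    rw [hF s hs, hF t ht] at hxy
    rw [polyline_injOn hN hclosed hinj hadj hs ht hxy]
  have hrange : Set.range F =
      ⋃ k ∈ Set.Iio N, (Stitch.between (p k) (p (k + 1))).seg := by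
    rw [← image_polyline hclosed hadj]
    ext q
    constructor
    · rintro ⟨x, rfl⟩
      obtain ⟨s, hs, rfl⟩ := hrep x
      exact ⟨s, hs, (hF s hs).symm⟩
    · rintro ⟨s, hs, rfl⟩
      exact ⟨s, hF s hs⟩
  obtain ⟨g⟩ := nonempty_circle_homeomorph_sphere
  exact ⟨(((hcont.isClosedEmbedding hFinj).isEmbedding.toHomeomorph.trans
    (Homeomorph.setCongr hrange)).symm.trans (AddCircle.homeomorphCircle hpos.ne')).trans g⟩

/-- The height profile of a battlement: `1, 0, 0, 1, 1, 0, 0, 1, …`. -/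
def tooth (k : ℕ) : ℤ := 1 - (((k + 1) / 2 % 2 : ℕ) : ℤ)

/-- The vertices of the `m × n` rug in counterclockwise order, starting at `(1,1)`. -/
def rugVertex (m n k : ℕ) : ℤ × ℤ :=
  if k < 2 * n - 3 then (1 + ((k / 2 : ℕ) : ℤ), tooth k)
  else if k < (2 * n - 3) + (2 * m - 3) then
    (n - tooth (k - (2 * n - 3)), 1 + (((k - (2 * n - 3)) / 2 : ℕ) : ℤ))
  else if k < 2 * (2 * n - 3) + (2 * m - 3) then
    (n - 1 - (((k - (2 * n - 3) - (2 * m - 3)) / 2 : ℕ) : ℤ),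
      m - tooth (k - (2 * n - 3) - (2 * m - 3)))
  else
    (tooth (k - 2 * (2 * n - 3) - (2 * m - 3)),
      m - 1 - (((k - 2 * (2 * n - 3) - (2 * m - 3)) / 2 : ℕ) : ℤ))

/-- The vertical unit segment upwards from `(i,j)` belongs to the rug of width `n` and
height `m`. -/
def IsRugEdge (n m : ℕ) (i j : ℤ) : Prop :=
  0 ≤ i ∧ i ≤ n ∧ 0 ≤ j ∧ j ≤ m - 1 ∧ ((1 ≤ i ∧ i ≤ n - 1) ∨ j % 2 = 1) ∧
    (i = 0 ∨ i = n ∨ j = 0 ∨ j = m - 1 ∨ ((i = 1 ∨ i = n - 1) ∧ j % 2 = 0))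

/-- The stitches of the `m × n` rug. -/
def rugStitches (m n : ℕ) : Finset Stitch :=
  (Finset.range (4 * m + 4 * n - 12)).image
    fun k => Stitch.between (rugVertex m n k) (rugVertex m n (k + 1))

section Rug

variable {m n : ℕ}

lemma rugVertex_bottom (hm3 : 3 ≤ m) (hn3 : 3 ≤ n) (hno : n % 2 = 1) {k : ℕ}
    (hk : k ≤ 2 * n - 3) : rugVertex m n k = (1 + ((k / 2 : ℕ) : ℤ), tooth k) := by
  simp only [rugVertex, tooth]
  split_ifs <;> simp only [Prod.mk.injEq] <;> omega

lemma rugVertex_right (hm3 : 3 ≤ m) (hn3 : 3 ≤ n) (hmo : m % 2 = 1) {k : ℕ}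
    (hk : k ≤ 2 * m - 3) :
    rugVertex m n ((2 * n - 3) + k) = (n - tooth k, 1 + ((k / 2 : ℕ) : ℤ)) := by
  simp only [rugVertex, tooth]
  split_ifs <;> simp only [Prod.mk.injEq] <;> omega

lemma rugVertex_top (hm3 : 3 ≤ m) (hn3 : 3 ≤ n) (hno : n % 2 = 1) {k : ℕ}
    (hk : k ≤ 2 * n - 3) :
    rugVertex m n ((2 * n - 3) + (2 * m - 3) + k) =
      (n - 1 - ((k / 2 : ℕ) : ℤ), m - tooth k) := by
  simp only [rugVertex, tooth]
  split_ifs <;> simp only [Prod.mk.injEq] <;> omega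

lemma rugVertex_left (k : ℕ) :
    rugVertex m n (2 * (2 * n - 3) + (2 * m - 3) + k) =
      (tooth k, m - 1 - ((k / 2 : ℕ) : ℤ)) := by
  simp only [rugVertex, tooth]
  split_ifs <;> simp only [Prod.mk.injEq] <;> omega

lemma rugVertex_closed (hm3 : 3 ≤ m) (hn3 : 3 ≤ n) (hmo : m % 2 = 1) :
    rugVertex m n (4 * m + 4 * n - 12) = rugVertex m n 0 := by
  simp only [rugVertex, tooth]
  split_ifs <;> simp only [Prod.mk.injEq] <;> omega

lemma rugVertex_adj (hm3 : 3 ≤ m) (hn3 : 3 ≤ n) (hmo : m % 2 = 1) (hno : n % 2 = 1) (k : ℕ) :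
    LatticeAdj (rugVertex m n k) (rugVertex m n (k + 1)) := by
  simp only [rugVertex, tooth, LatticeAdj]
  split_ifs <;> simp only <;> omega

lemma rugVertex_injOn (hm3 : 3 ≤ m) (hn3 : 3 ≤ n) (hmo : m % 2 = 1) (hno : n % 2 = 1) :
    Set.InjOn (rugVertex m n) (Set.Iio (4 * m + 4 * n - 12)) := by
  intro k hk l hl h
  simp only [Set.mem_Iio] at hk hl
  simp only [rugVertex, tooth] at h
  split_ifs at h <;> simp only [Prod.mk.injEq] at h <;> omega

lemma card_rugStitches (hm3 : 3 ≤ m) (hn3 : 3 ≤ n) (hmo : m % 2 = 1) (hno : n % 2 = 1) :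
    (rugStitches m n).card = 4 * m + 4 * n - 12 := by
  rw [rugStitches, Finset.card_image_of_injOn, Finset.card_range]
  intro k hk l hl h
  simp only [Finset.coe_range, Set.mem_Iio] at hk hl
  exact between_injOn (by omega) (rugVertex_closed hm3 hn3 hmo)
    (rugVertex_injOn hm3 hn3 hmo hno) (fun k _ => rugVertex_adj hm3 hn3 hmo hno k) hk hl h

lemma isCircle_rugStitches (hm3 : 3 ≤ m) (hn3 : 3 ≤ n) (hmo : m % 2 = 1) (hno : n % 2 = 1) :
    IsCircle (curveOf ↑(rugStitches m n)) := by
  have := isCircle_of_lattice_cycle (by omega) (rugVertex_closed hm3 hn3 hmo)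
    (rugVertex_injOn hm3 hn3 hmo hno) (fun k _ => rugVertex_adj hm3 hn3 hmo hno k)
  convert this using 1
  simp [curveOf, rugStitches]

lemma vert_mem_rugStitches (hm3 : 3 ≤ m) (hn3 : 3 ≤ n) (hmo : m % 2 = 1) (hno : n % 2 = 1)
    {i j : ℤ} : Stitch.vert i j ∈ rugStitches m n ↔ IsRugEdge n m i j := by
  simp only [rugStitches, Finset.mem_image, Finset.mem_range]
  constructor
  · rintro ⟨k, hk, h⟩
    simp only [Stitch.between, rugVertex, tooth] at h
    simp only [IsRugEdge]
    split_ifs at h <;> simp only [Stitch.vert.injEq] at h <;> simp only at * <;> omega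
  · intro h
    simp only [IsRugEdge] at h
    have key : ∃ k < 4 * m + 4 * n - 12, (rugVertex m n k).1 = i ∧ (rugVertex m n (k + 1)).1 = i ∧
        min (rugVertex m n k).2 (rugVertex m n (k + 1)).2 = j := by
      by_cases h1 : j = 0
      · refine ⟨2 * (i - 1).toNat, ?_, ?_⟩
        · omega
        · rw [rugVertex_bottom hm3 hn3 hno (by omega), rugVertex_bottom hm3 hn3 hno (by omega)]
          simp only [tooth]
          omega
      by_cases h2 : j = m - 1
      · refine ⟨(2 * n - 3) + (2 * m - 3) + 2 * (n - 1 - i).toNat, ?_, ?_⟩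
        · omega
        · rw [add_assoc _ _ 1, rugVertex_top hm3 hn3 hno (by omega),
            rugVertex_top hm3 hn3 hno (by omega)]
          simp only [tooth]
          omega
      by_cases h3 : i ≤ 1
      · refine ⟨2 * (2 * n - 3) + (2 * m - 3) + (2 * (m - 1 - j).toNat - 1), ?_, ?_⟩
        · omega
        · rw [add_assoc _ _ 1, rugVertex_left, rugVertex_left]
          simp only [tooth]
          omega
      · refine ⟨(2 * n - 3) + (2 * j.toNat - 1), ?_, ?_⟩
        · omega
        · rw [add_assoc _ _ 1, rugVertex_right hm3 hn3 hmo (by omega),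
            rugVertex_right hm3 hn3 hmo (by omega)]
          simp only [tooth]
          omega
    obtain ⟨k, hk, h1, h2, h3⟩ := key
    exact ⟨k, hk, by rw [Stitch.between, if_pos (h1.trans h2.symm), h1, h3]⟩

lemma horiz_mem_rugStitches (hm3 : 3 ≤ m) (hn3 : 3 ≤ n) (hmo : m % 2 = 1) (hno : n % 2 = 1)
    {i j : ℤ} : Stitch.horiz i j ∈ rugStitches m n ↔ IsRugEdge m n j i := by
  simp only [rugStitches, Finset.mem_image, Finset.mem_range]
  constructor
  · rintro ⟨k, hk, h⟩
    have hadj := rugVertex_adj hm3 hn3 hmo hno k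
    simp only [Stitch.between, LatticeAdj, rugVertex, tooth] at h hadj
    simp only [IsRugEdge]
    split_ifs at h hadj <;> simp only [Stitch.horiz.injEq] at h <;>
      simp only at * <;> omega
  · intro h
    simp only [IsRugEdge] at h
    have key : ∃ k < 4 * m + 4 * n - 12, (rugVertex m n k).2 = j ∧
        (rugVertex m n k).1 ≠ (rugVertex m n (k + 1)).1 ∧
        min (rugVertex m n k).1 (rugVertex m n (k + 1)).1 = i := by
      by_cases h1 : i = 0
      · refine ⟨2 * (2 * n - 3) + (2 * m - 3) + 2 * (m - 1 - j).toNat, ?_, ?_⟩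
        · omega
        · rw [add_assoc _ _ 1, rugVertex_left, rugVertex_left]
          simp only [tooth]
          omega
      by_cases h2 : i = n - 1
      · refine ⟨(2 * n - 3) + 2 * (j - 1).toNat, ?_, ?_⟩
        · omega
        · rw [add_assoc _ _ 1, rugVertex_right hm3 hn3 hmo (by omega),
            rugVertex_right hm3 hn3 hmo (by omega)]
          simp only [tooth]
          omega
      by_cases h3 : j ≤ 1
      · refine ⟨2 * i.toNat - 1, ?_, ?_⟩
        · omega
        · rw [rugVertex_bottom hm3 hn3 hno (by omega), rugVertex_bottom hm3 hn3 hno (by omega)]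
          simp only [tooth]
          omega
      · refine ⟨(2 * n - 3) + (2 * m - 3) + (2 * (n - 1 - i).toNat - 1), ?_, ?_⟩
        · omega
        · rw [add_assoc _ _ 1, rugVertex_top hm3 hn3 hno (by omega),
            rugVertex_top hm3 hn3 hno (by omega)]
          simp only [tooth]
          omega
    obtain ⟨k, hk, h1, h2, h3⟩ := key
    exact ⟨k, hk, by rw [Stitch.between, if_neg h2, h1, h3]⟩

end Rug

/-- The closed region bounded by the rug of width `n` and height `m`, in coordinates. The teeth
are the unit intervals on which `sin (π x)` is nonpositive. -/
def RugClosed (n m : ℕ) (x y : ℝ) : Prop :=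
  0 ≤ x ∧ x ≤ n ∧ 0 ≤ y ∧ y ≤ m ∧
    (((1 ≤ x ∧ x ≤ n - 1) ∧ (1 ≤ y ∧ y ≤ m - 1)) ∨
      ((1 ≤ x ∧ x ≤ n - 1) ∧ Real.sin (x * Real.pi) ≤ 0) ∨
      ((1 ≤ y ∧ y ≤ m - 1) ∧ Real.sin (y * Real.pi) ≤ 0))

/-- The open region bounded by the rug of width `n` and height `m`, in coordinates. -/
def RugOpen (n m : ℕ) (x y : ℝ) : Prop :=
  0 < x ∧ x < n ∧ 0 < y ∧ y < m ∧
    ((1 < y ∧ y < m - 1) ∨ Real.sin (x * Real.pi) < 0) ∧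
    ((1 < x ∧ x < n - 1) ∨ Real.sin (y * Real.pi) < 0)

lemma RugClosed.swap {n m : ℕ} {x y : ℝ} (h : RugClosed n m x y) : RugClosed m n y x := by
  simp only [RugClosed] at h ⊢
  tauto

lemma RugOpen.swap {n m : ℕ} {x y : ℝ} (h : RugOpen n m x y) : RugOpen m n y x := by
  simp only [RugOpen] at h ⊢
  tauto

section SinPi

variable {j : ℤ} {y : ℝ}

lemma sin_mul_pi_eq (j : ℤ) (y : ℝ) :
    Real.sin (y * Real.pi) = (-1) ^ j * Real.sin ((y - j) * Real.pi) := by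
  rw [← Real.sin_add_int_mul_pi]
  ring_nf

lemma sin_mul_pi_nonneg (hj : j % 2 = 0) (h1 : j ≤ y) (h2 : y ≤ j + 1) :
    0 ≤ Real.sin (y * Real.pi) := by
  rw [sin_mul_pi_eq j, (Int.even_iff.2 hj).neg_one_zpow, one_mul]
  exact Real.sin_nonneg_of_nonneg_of_le_pi (mul_nonneg (by linarith) Real.pi_pos.le)
    (by nlinarith [Real.pi_pos])

lemma sin_mul_pi_nonpos (hj : j % 2 = 1) (h1 : j ≤ y) (h2 : y ≤ j + 1) :
    Real.sin (y * Real.pi) ≤ 0 := by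
  rw [sin_mul_pi_eq j, (Int.odd_iff.2 hj).neg_one_zpow, neg_one_mul, neg_nonpos]
  exact Real.sin_nonneg_of_nonneg_of_le_pi (mul_nonneg (by linarith) Real.pi_pos.le)
    (by nlinarith [Real.pi_pos])

lemma sin_mul_pi_ne_zero (hy : ∀ j : ℤ, y ≠ j) : Real.sin (y * Real.pi) ≠ 0 := by
  intro h
  obtain ⟨k, hk⟩ := Real.sin_eq_zero_iff.1 h
  exact hy k (mul_right_cancel₀ Real.pi_ne_zero hk).symm

lemma exists_odd_floor (h : Real.sin (y * Real.pi) < 0) :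
    ∃ j : ℤ, j % 2 = 1 ∧ (j : ℝ) < y ∧ y < j + 1 := by
  have h1 := Int.floor_le y
  have h2 := Int.lt_floor_add_one y
  refine ⟨⌊y⌋, ?_, lt_of_le_of_ne h1 ?_, h2⟩
  · by_contra hj
    exact (sin_mul_pi_nonneg (by omega) h1 h2.le).not_gt h
  · intro he
    rw [← he, Real.sin_int_mul_pi] at h
    exact h.false

lemma mem_Ioo_of_sin_neg {n : ℕ} (hno : n % 2 = 1) (h0 : 0 < y) (hn : y < n)
    (h : Real.sin (y * Real.pi) < 0) : 1 < y ∧ y < n - 1 := by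
  obtain ⟨j, hj, h1, h2⟩ := exists_odd_floor h
  have a1 : (-1 : ℝ) < j := by linarith
  have a2 : (j : ℝ) < n := by linarith
  have a3 : -1 < j := by exact_mod_cast a1
  have a4 : j < n := by exact_mod_cast a2
  have b1 : (1 : ℝ) ≤ j := by exact_mod_cast (by omega : 1 ≤ j)
  have b2 : (j : ℝ) + 1 ≤ n - 1 := by exact_mod_cast (by omega : j + 1 ≤ (n : ℤ) - 1)
  exact ⟨by linarith, by linarith⟩

end SinPi

section Region

variable {n m : ℕ} {i j : ℤ} {x y : ℝ}

lemma IsRugEdge.rugClosed (hmo : m % 2 = 1) (h : IsRugEdge n m i j) (h1 : j ≤ y)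
    (h2 : y ≤ j + 1) : RugClosed n m i y := by
  obtain ⟨a1, a2, a3, a4, a5, -⟩ := h
  have b1 : (0 : ℝ) ≤ i := by exact_mod_cast a1
  have b2 : (i : ℝ) ≤ n := by exact_mod_cast a2
  have b3 : (0 : ℝ) ≤ j := by exact_mod_cast a3
  have b4 : (j : ℝ) ≤ m - 1 := by exact_mod_cast a4
  refine ⟨b1, b2, by linarith, by linarith, ?_⟩
  rcases a5 with ⟨a5, a6⟩ | hj
  · exact Or.inr (Or.inl ⟨⟨by exact_mod_cast a5, by exact_mod_cast a6⟩,
      (Real.sin_int_mul_pi i).le⟩)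
  · have a7 : 1 ≤ j := by omega
    have a8 : j + 1 ≤ m - 1 := by omega
    have b7 : (1 : ℝ) ≤ j := by exact_mod_cast a7
    have b8 : (j : ℝ) + 1 ≤ m - 1 := by exact_mod_cast a8
    exact Or.inr (Or.inr ⟨⟨by linarith, by linarith⟩, sin_mul_pi_nonpos hj h1 h2⟩)

lemma IsRugEdge.not_rugOpen (h : IsRugEdge n m i j) (h1 : j ≤ y)
    (h2 : y ≤ j + 1) : ¬ RugOpen n m i y := by
  rintro ⟨c1, c2, c3, c4, c5, c6⟩
  obtain ⟨-, -, -, -, -, a6⟩ := h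
  have c5 := c5.resolve_right (Real.sin_int_mul_pi i).not_lt
  rcases a6 with rfl | rfl | rfl | rfl | ⟨h6, hj⟩
  · simp at c1
  · simp at c2
  · push_cast at h2
    linarith
  · push_cast at h1
    linarith
  · have c6 := c6.resolve_right (sin_mul_pi_nonneg hj h1 h2).not_gt
    rcases h6 with rfl | rfl <;> push_cast at c6 <;> linarith

lemma exists_isRugEdge (hm3 : 3 ≤ m) (hn3 : 3 ≤ n) (hmo : m % 2 = 1) (hno : n % 2 = 1)
    (hc : RugClosed n m i y) (ho : ¬ RugOpen n m i y) :
    ∃ j : ℤ, IsRugEdge n m i j ∧ (j : ℝ) ≤ y ∧ y ≤ j + 1 := by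
  obtain ⟨c1, c2, c3, c4, c5⟩ := hc
  have a1 : 0 ≤ i := by exact_mod_cast c1
  have a2 : i ≤ n := by exact_mod_cast c2
  by_cases hy : ∃ j : ℤ, y = j
  · obtain ⟨j, rfl⟩ := hy
    have a3 : 0 ≤ j := by exact_mod_cast c3
    have a4 : j ≤ m := by exact_mod_cast c4
    have a5 : (1 ≤ i ∧ i ≤ n - 1) ∨ (1 ≤ j ∧ j ≤ m - 1) := by
      have : ((1 : ℝ) ≤ i ∧ (i : ℝ) ≤ n - 1) ∨ ((1 : ℝ) ≤ j ∧ (j : ℝ) ≤ m - 1) := by tauto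
      exact_mod_cast this
    have a6 : ¬ ((1 < i ∧ i < n - 1) ∧ (1 < j ∧ j < m - 1)) := by
      intro h
      have : ((1 : ℝ) < i ∧ (i : ℝ) < n - 1) ∧ ((1 : ℝ) < j ∧ (j : ℝ) < m - 1) := by
        exact_mod_cast h
      obtain ⟨h1, h2⟩ := this
      exact ho ⟨by linarith, by linarith, by linarith, by linarith, Or.inl h2, Or.inl h1⟩
    by_cases h : IsRugEdge n m i j
    · exact ⟨j, h, le_rfl, by linarith⟩
    · refine ⟨j - 1, ?_, by push_cast; linarith, by push_cast; linarith⟩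
      simp only [IsRugEdge] at h ⊢
      omega
  · push Not at hy
    have h1 : (⌊y⌋ : ℝ) < y := lt_of_le_of_ne (Int.floor_le y) (hy _).symm
    have h2 : y < ⌊y⌋ + 1 := Int.lt_floor_add_one y
    refine ⟨⌊y⌋, ?_, h1.le, h2.le⟩
    generalize ⌊y⌋ = j at h1 h2
    have a3 : 0 ≤ j := by
      have : (-1 : ℝ) < j := by linarith
      have : -1 < j := by exact_mod_cast this
      omega
    have a4 : j ≤ m - 1 := by
      have : (j : ℝ) < m := by linarith
      have : j < m := by exact_mod_cast this
      omega
    have a5 : (1 ≤ i ∧ i ≤ n - 1) ∨ j % 2 = 1 := by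
      by_contra! h
      have hA : ¬ ((1 : ℝ) ≤ i ∧ (i : ℝ) ≤ n - 1) := by
        intro h'
        have : 1 ≤ i ∧ i ≤ n - 1 := by exact_mod_cast h'
        omega
      have hs := sin_mul_pi_nonneg (j := j) (by omega) h1.le h2.le
      have := lt_of_le_of_ne hs (sin_mul_pi_ne_zero hy).symm
      rcases c5 with c5 | c5 | c5
      · exact hA c5.1
      · exact hA c5.1
      · linarith [c5.2]
    have a6 : ¬ (0 < i ∧ i < n ∧ 1 ≤ j ∧ j + 1 ≤ m - 1 ∧ ((1 < i ∧ i < n - 1) ∨ j % 2 = 1)) := by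
      rintro ⟨d1, d2, d3, d4, d5⟩
      have e1 : (0 : ℝ) < i := by exact_mod_cast d1
      have e2 : (i : ℝ) < n := by exact_mod_cast d2
      have e3 : (1 : ℝ) ≤ j := by exact_mod_cast d3
      have e4 : (j : ℝ) + 1 ≤ m - 1 := by exact_mod_cast d4
      refine ho ⟨e1, e2, by linarith, by linarith, Or.inl ⟨by linarith, by linarith⟩, ?_⟩
      rcases d5 with d5 | d5
      · exact Or.inl (by exact_mod_cast d5)
      · exact Or.inr (lt_of_le_of_ne (sin_mul_pi_nonpos d5 h1.le h2.le) (sin_mul_pi_ne_zero hy))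
    simp only [IsRugEdge]
    omega

lemma RugClosed.rugOpen (hx : ∀ i : ℤ, x ≠ i) (hy : ∀ j : ℤ, y ≠ j) (h : RugClosed n m x y) :
    RugOpen n m x y := by
  obtain ⟨c1, c2, c3, c4, c5⟩ := h
  have hx' : ∀ i : ℤ, (i : ℝ) ≠ x := fun i => (hx i).symm
  have hy' : ∀ i : ℤ, (i : ℝ) ≠ y := fun i => (hy i).symm
  refine ⟨lt_of_le_of_ne c1 (by exact_mod_cast hx' 0), lt_of_le_of_ne c2 (by exact_mod_cast hx n),
    lt_of_le_of_ne c3 (by exact_mod_cast hy' 0), lt_of_le_of_ne c4 (by exact_mod_cast hy m), ?_⟩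
  have hA : (1 ≤ x ∧ x ≤ n - 1) → (1 < x ∧ x < n - 1) := fun h =>
    ⟨lt_of_le_of_ne h.1 (by exact_mod_cast hx' 1),
      lt_of_le_of_ne h.2 (by exact_mod_cast hx (n - 1))⟩
  have hB : (1 ≤ y ∧ y ≤ m - 1) → (1 < y ∧ y < m - 1) := fun h =>
    ⟨lt_of_le_of_ne h.1 (by exact_mod_cast hy' 1),
      lt_of_le_of_ne h.2 (by exact_mod_cast hy (m - 1))⟩
  have hsx : Real.sin (x * Real.pi) ≤ 0 → Real.sin (x * Real.pi) < 0 :=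
    fun h => lt_of_le_of_ne h (sin_mul_pi_ne_zero hx)
  have hsy : Real.sin (y * Real.pi) ≤ 0 → Real.sin (y * Real.pi) < 0 :=
    fun h => lt_of_le_of_ne h (sin_mul_pi_ne_zero hy)
  tauto

lemma mem_curveOf_rugStitches (hm3 : 3 ≤ m) (hn3 : 3 ≤ n) (hmo : m % 2 = 1) (hno : n % 2 = 1)
    {q : ℝ × ℝ} : q ∈ curveOf ↑(rugStitches m n) ↔
      RugClosed n m q.1 q.2 ∧ ¬ RugOpen n m q.1 q.2 := by
  obtain ⟨x, y⟩ := q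
  simp only [curveOf, Set.mem_iUnion, Finset.mem_coe, exists_prop]
  constructor
  · rintro ⟨s, hs, hq⟩
    cases s with
    | vert i j =>
      rw [vert_mem_rugStitches hm3 hn3 hmo hno] at hs
      obtain ⟨rfl, h1, h2⟩ := Stitch.mem_seg_vert.1 hq
      exact ⟨hs.rugClosed hmo h1 h2, hs.not_rugOpen h1 h2⟩
    | horiz i j =>
      rw [horiz_mem_rugStitches hm3 hn3 hmo hno] at hs
      obtain ⟨rfl, h1, h2⟩ := Stitch.mem_seg_horiz.1 hq
      exact ⟨(hs.rugClosed hno h1 h2).swap, fun h => hs.not_rugOpen h1 h2 h.swap⟩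
  · rintro ⟨hc, ho⟩
    by_cases hx : ∃ i : ℤ, x = i
    · obtain ⟨i, rfl⟩ := hx
      obtain ⟨j, hj, h⟩ := exists_isRugEdge hm3 hn3 hmo hno hc ho
      exact ⟨.vert i j, (vert_mem_rugStitches hm3 hn3 hmo hno).2 hj,
        Stitch.mem_seg_vert.2 ⟨rfl, h⟩⟩
    by_cases hy : ∃ j : ℤ, y = j
    · obtain ⟨j, rfl⟩ := hy
      obtain ⟨i, hi, h⟩ := exists_isRugEdge hn3 hm3 hno hmo hc.swap fun h => ho h.swap
      exact ⟨.horiz i j, (horiz_mem_rugStitches hm3 hn3 hmo hno).2 hi,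
        Stitch.mem_seg_horiz.2 ⟨rfl, h⟩⟩
    · push Not at hx hy
      exact absurd (hc.rugOpen hx hy) ho

lemma RugOpen.rugClosed (hno : n % 2 = 1) (h : RugOpen n m x y) : RugClosed n m x y := by
  obtain ⟨c1, c2, c3, c4, c5, c6⟩ := h
  refine ⟨c1.le, c2.le, c3.le, c4.le, ?_⟩
  rcases c5 with c5 | c5
  · rcases c6 with c6 | c6
    · exact Or.inl ⟨⟨c6.1.le, c6.2.le⟩, ⟨c5.1.le, c5.2.le⟩⟩
    · exact Or.inr (Or.inr ⟨⟨c5.1.le, c5.2.le⟩, c6.le⟩)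
  · have := mem_Ioo_of_sin_neg hno c1 c2 c5
    exact Or.inr (Or.inl ⟨⟨this.1.le, this.2.le⟩, c5.le⟩)

lemma isOpen_rugOpen : IsOpen {q : ℝ × ℝ | RugOpen n m q.1 q.2} := by
  have hx : IsOpen {q : ℝ × ℝ | Real.sin (q.1 * Real.pi) < 0} :=
    isOpen_lt (by fun_prop) continuous_const
  have hy : IsOpen {q : ℝ × ℝ | Real.sin (q.2 * Real.pi) < 0} :=
    isOpen_lt (by fun_prop) continuous_const
  have hfl : ∀ c : ℝ, IsOpen {q : ℝ × ℝ | c < q.1} :=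
    fun c => isOpen_lt continuous_const continuous_fst
  have hfr : ∀ c : ℝ, IsOpen {q : ℝ × ℝ | q.1 < c} :=
    fun c => isOpen_lt continuous_fst continuous_const
  have hsl : ∀ c : ℝ, IsOpen {q : ℝ × ℝ | c < q.2} :=
    fun c => isOpen_lt continuous_const continuous_snd
  have hsr : ∀ c : ℝ, IsOpen {q : ℝ × ℝ | q.2 < c} :=
    fun c => isOpen_lt continuous_snd continuous_const
  exact (hfl 0).inter <| (hfr n).inter <| (hsl 0).inter <| (hsr m).inter <|
    (((hsl 1).inter (hsr (m - 1))).union hx).inter (((hfl 1).inter (hfr (n - 1))).union hy)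

lemma isClosed_rugClosed : IsClosed {q : ℝ × ℝ | RugClosed n m q.1 q.2} := by
  have hx : IsClosed {q : ℝ × ℝ | Real.sin (q.1 * Real.pi) ≤ 0} :=
    isClosed_le (by fun_prop) continuous_const
  have hy : IsClosed {q : ℝ × ℝ | Real.sin (q.2 * Real.pi) ≤ 0} :=
    isClosed_le (by fun_prop) continuous_const
  have hf : ∀ c d : ℝ, IsClosed {q : ℝ × ℝ | c ≤ q.1 ∧ q.1 ≤ d} := fun c d =>
    (isClosed_le continuous_const continuous_fst).inter
      (isClosed_le continuous_fst continuous_const)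
  have hs : ∀ c d : ℝ, IsClosed {q : ℝ × ℝ | c ≤ q.2 ∧ q.2 ≤ d} := fun c d =>
    (isClosed_le continuous_const continuous_snd).inter
      (isClosed_le continuous_snd continuous_const)
  convert! (hf 0 n).inter ((hs 0 m).inter (((hf 1 (n - 1)).inter (hs 1 (m - 1))).union
    (((hf 1 (n - 1)).inter hx).union ((hs 1 (m - 1)).inter hy)))) using 1
  ext q
  simp only [RugClosed, Set.mem_ofPred_eq, Set.mem_inter_iff, Set.mem_union]
  tauto

/-- From every point outside the closed region, a ray parallel to an axis escapes to infinity. -/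
lemma exists_escaping_ray (hm3 : 3 ≤ m) (hn3 : 3 ≤ n) (q : ℝ × ℝ)
    (hq : ¬ RugClosed n m q.1 q.2) :
    ∃ v : ℝ × ℝ, v ≠ 0 ∧ ∀ t : ℝ, 0 ≤ t → ¬ RugClosed n m (q + t • v).1 (q + t • v).2 := by
  obtain ⟨x, y⟩ := q
  simp only [RugClosed] at hq
  have hm : (3 : ℝ) ≤ m := by exact_mod_cast hm3
  have hn : (3 : ℝ) ≤ n := by exact_mod_cast hn3
  by_cases hx1 : x < 1
  · refine ⟨(-1, 0), by simp, fun t ht => ?_⟩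
    simp only [Prod.smul_mk, Prod.mk_add_mk, smul_eq_mul, mul_neg, mul_one, mul_zero, add_zero]
    rintro ⟨d1, d2, d3, d4, d5 | d5 | d5⟩
    · linarith [d5.1.1]
    · linarith [d5.1.1]
    · exact hq ⟨by linarith, by linarith, d3, d4, Or.inr (Or.inr d5)⟩
  by_cases hx2 : n - 1 < x
  · refine ⟨(1, 0), by simp, fun t ht => ?_⟩
    simp only [Prod.smul_mk, Prod.mk_add_mk, smul_eq_mul, mul_one, mul_zero, add_zero]
    rintro ⟨d1, d2, d3, d4, d5 | d5 | d5⟩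
    · linarith [d5.1.2]
    · linarith [d5.1.2]
    · exact hq ⟨by linarith, by linarith, d3, d4, Or.inr (Or.inr d5)⟩
  push Not at hx1 hx2
  by_cases hy1 : y < 1
  · refine ⟨(0, -1), by simp, fun t ht => ?_⟩
    simp only [Prod.smul_mk, Prod.mk_add_mk, smul_eq_mul, mul_neg, mul_one, mul_zero, add_zero]
    rintro ⟨d1, d2, d3, d4, d5 | d5 | d5⟩
    · linarith [d5.2.1]
    · exact hq ⟨d1, d2, by linarith, by linarith, Or.inr (Or.inl d5)⟩
    · linarith [d5.1.1]
  by_cases hy2 : m - 1 < y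
  · refine ⟨(0, 1), by simp, fun t ht => ?_⟩
    simp only [Prod.smul_mk, Prod.mk_add_mk, smul_eq_mul, mul_one, mul_zero, add_zero]
    rintro ⟨d1, d2, d3, d4, d5 | d5 | d5⟩
    · linarith [d5.2.2]
    · exact hq ⟨d1, d2, by linarith, by linarith, Or.inr (Or.inl d5)⟩
    · linarith [d5.1.2]
  · push Not at hy1 hy2
    exact absurd ⟨by linarith, by linarith, by linarith, by linarith,
      Or.inl ⟨⟨hx1, hx2⟩, hy1, hy2⟩⟩ hq

/-- A connected component containing a ray is unbounded. -/
lemma not_isBounded_connectedComponentIn {S : Set (ℝ × ℝ)} {q v : ℝ × ℝ} (hv : v ≠ 0)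
    (h : ∀ t : ℝ, 0 ≤ t → q + t • v ∈ S) :
    ¬ Bornology.IsBounded (connectedComponentIn S q) := by
  intro hb
  have hpre : IsPreconnected ((fun t : ℝ => q + t • v) '' Set.Ici 0) :=
    isPreconnected_Ici.image _ (by fun_prop)
  have hsub : (fun t : ℝ => q + t • v) '' Set.Ici 0 ⊆ connectedComponentIn S q := by
    refine hpre.subset_connectedComponentIn ⟨0, Set.self_mem_Ici, by simp⟩ ?_
    rintro _ ⟨t, ht, rfl⟩
    exact h t ht
  obtain ⟨R, hR⟩ := (Metric.isBounded_iff_subset_closedBall q).1 (hb.subset hsub)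
  have hR0 : 0 ≤ R := by
    have := hR ⟨0, Set.self_mem_Ici, rfl⟩
    simpa using this
  have hv' : 0 < ‖v‖ := norm_pos_iff.2 hv
  have := hR ⟨(R + 1) / ‖v‖, Set.mem_Ici.2 (by positivity), rfl⟩
  rw [Metric.mem_closedBall, dist_self_add_left, norm_smul, Real.norm_of_nonneg (by positivity),
    div_mul_cancel₀ _ hv'.ne'] at this
  linarith

lemma intOf_curveOf_rugStitches (hm3 : 3 ≤ m) (hn3 : 3 ≤ n) (hmo : m % 2 = 1)
    (hno : n % 2 = 1) :
    intOf (curveOf ↑(rugStitches m n)) = {q | RugOpen n m q.1 q.2} := by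
  ext q
  simp only [intOf, Set.mem_ofPred_eq, mem_curveOf_rugStitches hm3 hn3 hmo hno]
  constructor
  · rintro ⟨hq, hb⟩
    by_contra ho
    have hc : ¬ RugClosed n m q.1 q.2 := fun hc => hq ⟨hc, ho⟩
    obtain ⟨v, hv, hray⟩ := exists_escaping_ray hm3 hn3 q hc
    refine not_isBounded_connectedComponentIn hv (fun t ht => ?_) hb
    rw [Set.mem_compl_iff, mem_curveOf_rugStitches hm3 hn3 hmo hno]
    exact fun h => hray t ht h.1
  · intro ho
    have hqC : q ∈ (curveOf ↑(rugStitches m n))ᶜ := by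
      rw [Set.mem_compl_iff, mem_curveOf_rugStitches hm3 hn3 hmo hno]
      exact fun h => h.2 ho
    refine ⟨fun h => h.2 ho, ?_⟩
    have hsub : connectedComponentIn (curveOf ↑(rugStitches m n))ᶜ q ⊆
        {q | RugOpen n m q.1 q.2} := by
      refine isPreconnected_connectedComponentIn.subset_left_of_subset_union isOpen_rugOpen
        (isClosed_rugClosed (n := n) (m := m)).isOpen_compl ?_ ?_ ⟨q, mem_connectedComponentIn hqC, ho⟩
      · exact Set.disjoint_left.2 fun p hp hp' => hp' (hp.rugClosed hno)
      · intro p hp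
        have := connectedComponentIn_subset _ _ hp
        rw [Set.mem_compl_iff, mem_curveOf_rugStitches hm3 hn3 hmo hno] at this
        by_cases h : RugOpen n m p.1 p.2
        · exact Or.inl h
        · exact Or.inr fun h' => this ⟨h', h⟩
    refine Bornology.IsBounded.subset ?_ hsub
    refine ((Metric.isBounded_Icc (0 : ℝ) n).prod (Metric.isBounded_Icc (0 : ℝ) m)).subset ?_
    rintro p ⟨h1, h2, h3, h4, -⟩
    exact ⟨⟨h1.le, h2.le⟩, h3.le, h4.le⟩

end Region

section Area

open MeasureTheory

lemma volume_teeth {n : ℕ} (hn3 : 3 ≤ n) (hno : n % 2 = 1) :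
    volume {x : ℝ | 0 < x ∧ x < n ∧ Real.sin (x * Real.pi) < 0} =
      ENNReal.ofReal (((n : ℝ) - 1) / 2) := by
  obtain ⟨a, rfl⟩ : ∃ a, n = 2 * a + 1 := ⟨n / 2, by omega⟩
  have : {x : ℝ | 0 < x ∧ x < ((2 * a + 1 : ℕ) : ℝ) ∧ Real.sin (x * Real.pi) < 0} =
      ⋃ k ∈ Finset.range a, Set.Ioo (2 * (k : ℝ) + 1) (2 * k + 2) := by
    ext x
    simp only [Set.mem_ofPred_eq, Set.mem_iUnion, Finset.mem_range, exists_prop, Set.mem_Ioo]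
    constructor
    · rintro ⟨h1, h2, h3⟩
      obtain ⟨j, hj, h4, h5⟩ := exists_odd_floor h3
      have a1 : (-1 : ℝ) < j := by linarith
      have a2 : (j : ℝ) < (2 * a + 1 : ℕ) := by linarith
      have a3 : -1 < j := by exact_mod_cast a1
      have a4 : j < (2 * a + 1 : ℕ) := by exact_mod_cast a2
      obtain ⟨k, rfl⟩ : ∃ k : ℕ, j = 2 * k + 1 := ⟨(j / 2).toNat, by omega⟩
      push_cast at h4 h5
      exact ⟨k, by omega, by linarith, by linarith⟩
    · rintro ⟨k, hk, h1, h2⟩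
      have hk' : (k : ℝ) + 1 ≤ a := by exact_mod_cast hk
      have hk0 : (0 : ℝ) ≤ k := k.cast_nonneg
      refine ⟨by linarith, by push_cast; linarith, lt_of_le_of_ne
        (sin_mul_pi_nonpos (j := 2 * k + 1) (by omega) (by push_cast; linarith)
          (by push_cast; linarith)) (sin_mul_pi_ne_zero ?_)⟩
      rintro j rfl
      have h3 : 2 * (k : ℤ) + 1 < j := by exact_mod_cast h1
      have h4 : j < 2 * (k : ℤ) + 2 := by exact_mod_cast h2
      omega
  rw [this, measure_biUnion_finset]
  · have : ∀ k : ℕ, volume (Set.Ioo (2 * (k : ℝ) + 1) (2 * k + 2)) = 1 := by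
      intro k
      rw [Real.volume_Ioo, show 2 * (k : ℝ) + 2 - (2 * k + 1) = 1 by ring, ENNReal.ofReal_one]
    simp [this]
  · intro k _ l _ hkl
    refine Set.disjoint_left.2 fun x hx hx' => hkl ?_
    have h1 : (2 * (k : ℝ) + 1) < 2 * l + 2 := hx.1.trans hx'.2
    have h2 : (2 * (l : ℝ) + 1) < 2 * k + 2 := hx'.1.trans hx.2
    norm_cast at h1 h2
    omega
  · exact fun _ _ => measurableSet_Ioo

lemma volume_margins {n : ℕ} (hn3 : 3 ≤ n) :
    volume (Set.Ioc (0 : ℝ) 1 ∪ Set.Ico ((n : ℝ) - 1) n) = 2 := by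
  have hn : (3 : ℝ) ≤ n := by exact_mod_cast hn3
  rw [measure_union _ measurableSet_Ico]
  · rw [Real.volume_Ioc, Real.volume_Ico]
    norm_num
  · exact Set.disjoint_left.2 fun x hx hx' => by linarith [hx.2, hx'.1]

lemma volume_rugOpen {m n : ℕ} (hm3 : 3 ≤ m) (hn3 : 3 ≤ n) (hmo : m % 2 = 1)
    (hno : n % 2 = 1) :
    volume {q : ℝ × ℝ | RugOpen n m q.1 q.2} =
      ENNReal.ofReal ((m : ℝ) * n - m - n + 2) := by
  have hn : (3 : ℝ) ≤ n := by exact_mod_cast hn3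
  have hm : (3 : ℝ) ≤ m := by exact_mod_cast hm3
  have hmeas : ∀ k : ℕ, MeasurableSet {x : ℝ | 0 < x ∧ x < k ∧ Real.sin (x * Real.pi) < 0} := by
    intro k
    have hs : IsOpen {x : ℝ | Real.sin (x * Real.pi) < 0} :=
      isOpen_lt (by fun_prop) continuous_const
    exact (isOpen_Ioi.inter (isOpen_Iio.inter hs)).measurableSet
  have hdecomp : {q : ℝ × ℝ | RugOpen n m q.1 q.2} =
      (Set.Ioo (1 : ℝ) (n - 1) ×ˢ Set.Ioo (1 : ℝ) (m - 1) ∪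
        {x : ℝ | 0 < x ∧ x < n ∧ Real.sin (x * Real.pi) < 0} ×ˢ
          (Set.Ioc (0 : ℝ) 1 ∪ Set.Ico ((m : ℝ) - 1) m)) ∪
        (Set.Ioc (0 : ℝ) 1 ∪ Set.Ico ((n : ℝ) - 1) n) ×ˢ
          {y : ℝ | 0 < y ∧ y < m ∧ Real.sin (y * Real.pi) < 0} := by
    ext ⟨x, y⟩
    simp only [Set.mem_ofPred_eq, Set.mem_union, Set.mem_prod, Set.mem_Ioo, Set.mem_Ioc,
      Set.mem_Ico]
    constructor
    · rintro ⟨c1, c2, c3, c4, c5, c6⟩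
      by_cases hA : 1 < x ∧ x < n - 1
      · by_cases hB : 1 < y ∧ y < m - 1
        · exact Or.inl (Or.inl ⟨hA, hB⟩)
        · refine Or.inl (Or.inr ⟨⟨c1, c2, c5.resolve_left hB⟩, ?_⟩)
          rcases le_or_gt y 1 with h | h
          · exact Or.inl ⟨c3, h⟩
          · exact Or.inr ⟨not_lt.1 fun h' => hB ⟨h, h'⟩, c4⟩
      · refine Or.inr ⟨?_, c3, c4, c6.resolve_left hA⟩
        rcases le_or_gt x 1 with h | h
        · exact Or.inl ⟨c1, h⟩
        · exact Or.inr ⟨not_lt.1 fun h' => hA ⟨h, h'⟩, c2⟩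
    · rintro ((⟨hA, hB⟩ | ⟨⟨c1, c2, hs⟩, hy⟩) | ⟨hx, ⟨c3, c4, hs⟩⟩)
      · exact ⟨by linarith, by linarith, by linarith, by linarith, Or.inl hB, Or.inl hA⟩
      · refine ⟨c1, c2, ?_, ?_, Or.inr hs, Or.inl (mem_Ioo_of_sin_neg hno c1 c2 hs)⟩ <;>
          rcases hy with hy | hy <;> linarith
      · refine ⟨?_, ?_, c3, c4, Or.inl (mem_Ioo_of_sin_neg hmo c3 c4 hs), Or.inr hs⟩ <;>
          rcases hx with hx | hx <;> linarith
  rw [hdecomp, measure_union, measure_union, Measure.volume_eq_prod, Measure.prod_prod,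
    Measure.prod_prod, Measure.prod_prod, volume_teeth hn3 hno, volume_teeth hm3 hmo,
    volume_margins hn3, volume_margins hm3, Real.volume_Ioo, Real.volume_Ioo,
    show (2 : ENNReal) = ENNReal.ofReal 2 by simp,
    ← ENNReal.ofReal_mul (by linarith), ← ENNReal.ofReal_mul (by linarith),
    ← ENNReal.ofReal_mul (by norm_num), ← ENNReal.ofReal_add (by nlinarith) (by linarith),
    ← ENNReal.ofReal_add (by nlinarith) (by linarith)]
  · congr 1
    ring
  · refine Set.disjoint_left.2 ?_
    rintro ⟨x, y⟩ ⟨-, hB⟩ ⟨-, hB' | hB'⟩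
    · exact (hB.1.trans_le hB'.2).false
    · exact (hB.2.trans_le hB'.1).false
  · exact (hmeas n).prod (measurableSet_Ioc.union measurableSet_Ico)
  · refine Set.disjoint_left.2 ?_
    rintro ⟨x, y⟩ h ⟨hA', -⟩
    have hA : 1 < x ∧ x < n - 1 := by
      rcases h with h | ⟨⟨c1, c2, hs⟩, -⟩
      · exact h.1
      · exact mem_Ioo_of_sin_neg hno c1 c2 hs
    rcases hA' with hA' | hA'
    · exact (hA.1.trans_le hA'.2).false
    · exact (hA.2.trans_le hA'.1).false
  · exact (measurableSet_Ioc.union measurableSet_Ico).prod (hmeas m)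

end Area

lemma sSup_sub_sInf_eq {S : Set ℝ} {a b : ℝ} (hS : S ⊆ Set.Icc a b) (ha : a ∈ S) (hb : b ∈ S) :
    sSup S - sInf S = b - a := by
  have h1 : IsGreatest S b := ⟨hb, fun _ h => (hS h).2⟩
  have h2 : IsLeast S a := ⟨ha, fun _ h => (hS h).1⟩
  rw [h1.csSup_eq, h2.csInf_eq]

lemma intCast_zmod_two_eq_ite {P : Prop} [Decidable P] {j : ℤ} (h : P ↔ j % 2 = 1) :
    (j : ZMod 2) = if P then 1 else 0 := by
  split_ifs with hP
  · have := (ZMod.intCast_eq_intCast_iff' j 1 2).2 (by simpa using h.1 hP)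
    simpa using this
  · have := (ZMod.intCast_eq_intCast_iff' j 0 2).2 (by have := mt h.2 hP; omega)
    simpa using this

lemma IsRugEdge.inPattern {m n : ℕ} (hn3 : 3 ≤ n) (hmo : m % 2 = 1) {i j : ℤ}
    (h : IsRugEdge n m i j) : (j : ZMod 2) = if i = 0 ∨ i = (n : ℤ) then 1 else 0 := by
  apply intCast_zmod_two_eq_ite
  simp only [IsRugEdge] at h
  omega

/-- For odd `m, n ≥ 3`, the `m × n` hitomezashi pattern with labels
`ε 0 = ε n = η 0 = η m = 1` and all other labels `0` contains a (rug-shaped) hitomezashi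
loop of width `n`, height `m`, length `4m + 4n − 12`, and area `mn − m − n + 2`. -/
theorem hitomezashi_rug_loop (m n : ℕ) (hm3 : 3 ≤ m) (hn3 : 3 ≤ n)
    (hmo : Odd m) (hno : Odd n) :
    ∃ L : HLoop (fun i : ℤ => if i = 0 ∨ i = (n : ℤ) then 1 else 0)
        (fun j : ℤ => if j = 0 ∨ j = (m : ℤ) then 1 else 0),
      curveOf ↑L.stitches ⊆ Set.Icc (0:ℝ) (n:ℝ) ×ˢ Set.Icc (0:ℝ) (m:ℝ) ∧
      loopWidth L = (n : ℝ) ∧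
      loopHeight L = (m : ℝ) ∧
      L.stitches.card = 4 * m + 4 * n - 12 ∧
      MeasureTheory.volume (intOf (curveOf ↑L.stitches)) =
        ENNReal.ofReal ((m : ℝ) * n - m - n + 2) := by
  rw [Nat.odd_iff] at hmo hno
  have hmem := fun q => mem_curveOf_rugStitches hm3 hn3 hmo hno (q := q)
  have hsub : curveOf ↑(rugStitches m n) ⊆ Set.Icc (0:ℝ) (n:ℝ) ×ˢ Set.Icc (0:ℝ) (m:ℝ) := by
    intro q hq
    obtain ⟨⟨h1, h2, h3, h4, -⟩, -⟩ := (hmem q).1 hq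
    exact ⟨⟨h1, h2⟩, h3, h4⟩
  have hvert : ∀ i j : ℤ, IsRugEdge n m i j → ((i : ℝ), (j : ℝ)) ∈ curveOf ↑(rugStitches m n) :=
    fun i j h => Set.mem_biUnion ((vert_mem_rugStitches hm3 hn3 hmo hno).2 h)
      (Stitch.mem_seg_vert.2 ⟨rfl, le_rfl, by simp⟩)
  have hhoriz : ∀ i j : ℤ, IsRugEdge m n j i → ((i : ℝ), (j : ℝ)) ∈ curveOf ↑(rugStitches m n) :=
    fun i j h => Set.mem_biUnion ((horiz_mem_rugStitches hm3 hn3 hmo hno).2 h)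
      (Stitch.mem_seg_horiz.2 ⟨rfl, le_rfl, by simp⟩)
  refine ⟨⟨rugStitches m n, ?_, isCircle_rugStitches hm3 hn3 hmo hno⟩, hsub, ?_, ?_,
    card_rugStitches hm3 hn3 hmo hno, ?_⟩
  · rintro (⟨i, j⟩ | ⟨i, j⟩) hs
    · exact ((vert_mem_rugStitches hm3 hn3 hmo hno).1 hs).inPattern hn3 hmo
    · exact ((horiz_mem_rugStitches hm3 hn3 hmo hno).1 hs).inPattern hm3 hno
  · have h1 := hvert 0 1 (by simp [IsRugEdge]; omega)
    have h2 := hvert n 1 (by simp [IsRugEdge]; omega)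
    have h := sSup_sub_sInf_eq (S := Prod.fst '' curveOf ↑(rugStitches m n)) (a := 0) (b := n)
      (Set.image_subset_iff.2 fun q hq => (hsub hq).1) ⟨_, h1, by simp⟩ ⟨_, h2, by simp⟩
    rwa [sub_zero] at h
  · have h1 := hhoriz 1 0 (by simp [IsRugEdge]; omega)
    have h2 := hhoriz 1 m (by simp [IsRugEdge]; omega)
    have h := sSup_sub_sInf_eq (S := Prod.snd '' curveOf ↑(rugStitches m n)) (a := 0) (b := m)
      (Set.image_subset_iff.2 fun q hq => (hsub hq).2) ⟨_, h1, by simp⟩ ⟨_, h2, by simp⟩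
    rwa [sub_zero] at h
  · exact (congrArg _ (intOf_curveOf_rugStitches hm3 hn3 hmo hno)).trans
      (volume_rugOpen hm3 hn3 hmo hno)
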